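/- arXiv:2309.14172 — 3 statements merged into one kernel-verified Lean document; each statement's English description precedes it below -/
import Mathlib

section
/- Let {M_m}_{m ∈ ι} be a finite family of n×n complex matrices with ∑_m M_m† M_m = I, let A and ρ be n×n complex matrices, and let a : ι → ℝ. Then (1/2)·∑_m Tr[M_m† M_m·((A − a_m·I)²·ρ + ρ·(A − a_m·I)²)] = ∑_m Tr[M_m·(A − a_m·I)·ρ·(A − a_m·I)·M_m†]. -/
open Matrix

/-- For a Kraus family `{M_m}` with `∑ M_m† M_m = I`,
`(1/2)·∑ Tr[M_m†M_m((A−a_m)²ρ + ρ(A−a_m)²)] = ∑ Tr[M_m(A−a_m)ρ(A−a_m)M_m†]`. -/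
theorem half_anticommutator_trace_eq {n : ℕ} {ι : Type*} [Fintype ι]
    (M : ι → Matrix (Fin n) (Fin n) ℂ)
    (hM : ∑ m, (M m)ᴴ * M m = 1)
    (A ρ : Matrix (Fin n) (Fin n) ℂ) (a : ι → ℝ) :
    (1 / 2 : ℂ) * ∑ m, Matrix.trace ((M m)ᴴ * M m *
        ((A - (a m : ℂ) • 1) ^ 2 * ρ + ρ * (A - (a m : ℂ) • 1) ^ 2)) =
      ∑ m, Matrix.trace
        (M m * (A - (a m : ℂ) • 1) * ρ * (A - (a m : ℂ) • 1) * (M m)ᴴ) := by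
  have key : ∀ m, Matrix.trace ((M m)ᴴ * M m *
        ((A - (a m : ℂ) • 1) ^ 2 * ρ + ρ * (A - (a m : ℂ) • 1) ^ 2)) =
      2 * Matrix.trace
        (M m * (A - (a m : ℂ) • 1) * ρ * (A - (a m : ℂ) • 1) * (M m)ᴴ) +
      Matrix.trace ((M m)ᴴ * M m * (A * (A * ρ - ρ * A) - (A * ρ - ρ * A) * A)) := by
    intro m
    have h1 : (A - (a m : ℂ) • (1 : Matrix (Fin n) (Fin n) ℂ)) ^ 2 * ρ
        + ρ * (A - (a m : ℂ) • 1) ^ 2 =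
        (2 : ℂ) • ((A - (a m : ℂ) • 1) * ρ * (A - (a m : ℂ) • 1)) +
        (A * (A * ρ - ρ * A) - (A * ρ - ρ * A) * A) := by
      simp only [pow_two, sub_mul, mul_sub, smul_mul_assoc, mul_smul_comm, one_mul, mul_one,
        mul_assoc, smul_sub]
      module
    have h2 : Matrix.trace
        (M m * (A - (a m : ℂ) • 1) * ρ * (A - (a m : ℂ) • 1) * (M m)ᴴ) =
        Matrix.trace ((M m)ᴴ * M m * ((A - (a m : ℂ) • 1) * ρ * (A - (a m : ℂ) • 1))) := by
      rw [Matrix.trace_mul_comm]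
      simp only [mul_assoc]
    rw [h1, h2, mul_add, Matrix.trace_add, mul_smul_comm, Matrix.trace_smul, smul_eq_mul]
  have hz : ∑ m, Matrix.trace
      ((M m)ᴴ * M m * (A * (A * ρ - ρ * A) - (A * ρ - ρ * A) * A)) = 0 := by
    rw [← Matrix.trace_sum, ← Finset.sum_mul, hM, one_mul, Matrix.trace_sub,
      Matrix.trace_mul_comm, sub_self]
  rw [Finset.sum_congr rfl (fun m _ => key m), Finset.sum_add_distrib, hz, ← Finset.mul_sum]
  ring
end

section
/- Let {M_m}_{m ∈ ι} be a finite family of n×n complex matrices with ∑_m M_m† M_m = I, and let B and ρ be n×n complex matrices. Then (1/2)·∑_m Tr[[B,[M_m,B]]·ρ·M_m† + M_m·ρ·[B,[M_m†,B]]] = ∑_m Tr[[M_m,B]·ρ·[M_m†,B]]. -/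
open Matrix

/-- For a Kraus family `{M_m}` with `∑ M_m† M_m = I`,
`(1/2)·∑ Tr[[B,[M_m,B]]ρM_m† + M_mρ[B,[M_m†,B]]] = ∑ Tr[[M_m,B]ρ[M_m†,B]]`,
where `[X,Y] = XY − YX`. -/
theorem half_double_commutator_trace_eq {n : ℕ} {ι : Type*} [Fintype ι]
    (M : ι → Matrix (Fin n) (Fin n) ℂ)
    (hM : ∑ m, (M m)ᴴ * M m = 1)
    (B ρ : Matrix (Fin n) (Fin n) ℂ) :
    (1 / 2 : ℂ) * ∑ m, Matrix.trace
        ((B * (M m * B - B * M m) - (M m * B - B * M m) * B) * ρ * (M m)ᴴ +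
          M m * ρ * (B * ((M m)ᴴ * B - B * (M m)ᴴ) - ((M m)ᴴ * B - B * (M m)ᴴ) * B)) =
      ∑ m, Matrix.trace ((M m * B - B * M m) * ρ * ((M m)ᴴ * B - B * (M m)ᴴ)) := by
  have key : ∀ X : Matrix (Fin n) (Fin n) ℂ,
      ∑ m, Matrix.trace (M m * X * (M m)ᴴ) = Matrix.trace X := by
    intro X
    calc ∑ m, Matrix.trace (M m * X * (M m)ᴴ)
        = ∑ m, Matrix.trace (((M m)ᴴ * M m) * X) := by
          refine Finset.sum_congr rfl fun m _ => ?_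
          rw [Matrix.trace_mul_comm, Matrix.mul_assoc]
      _ = Matrix.trace X := by
          rw [← Matrix.trace_sum, ← Finset.sum_mul, hM, Matrix.one_mul]
  have term : ∀ m, Matrix.trace
        ((B * (M m * B - B * M m) - (M m * B - B * M m) * B) * ρ * (M m)ᴴ +
          M m * ρ * (B * ((M m)ᴴ * B - B * (M m)ᴴ) - ((M m)ᴴ * B - B * (M m)ᴴ) * B)) =
      2 * Matrix.trace ((M m * B - B * M m) * ρ * ((M m)ᴴ * B - B * (M m)ᴴ)) +
        2 * Matrix.trace (M m * (B * ρ * B) * (M m)ᴴ)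
        - Matrix.trace (M m * (B * B * ρ) * (M m)ᴴ)
        - Matrix.trace (M m * (ρ * B * B) * (M m)ᴴ) := by
    intro m
    generalize (M m)ᴴ = N
    generalize M m = K
    have h1 := Matrix.trace_mul_comm B (K * B * ρ * N)
    have h2 := Matrix.trace_mul_comm B (K * ρ * B * N)
    have h3 := Matrix.trace_mul_comm B (K * ρ * N * B)
    have h4 := Matrix.trace_mul_comm B (B * K * ρ * N)
    simp only [Matrix.mul_sub, Matrix.sub_mul, Matrix.trace_add, Matrix.trace_sub,
      Matrix.mul_assoc] at h1 h2 h3 h4 ⊢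
    linear_combination 2 * h1 - 2 * h2 + h3 - h4
  have e1 : Matrix.trace (B * B * ρ) = Matrix.trace (B * ρ * B) := by
    rw [Matrix.mul_assoc, Matrix.trace_mul_comm]
  have e2 : Matrix.trace (ρ * B * B) = Matrix.trace (B * ρ * B) := by
    rw [Matrix.trace_mul_comm, Matrix.mul_assoc]
  simp only [term, Finset.sum_add_distrib, Finset.sum_sub_distrib, ← Finset.mul_sum, key, e1, e2]
  ring
end

section
/- Let S and E be finite index sets, let U be a unitary matrix on ℂ^{S×E} (identified with the Kronecker-product space), let {|m⟩}_{m ∈ ι} be an orthonormal basis of ℂ^E, let a : ι → ℝ, and set the meter observable M_E := ∑_m a_m·|m⟩⟨m|. Let ρ be any |S|×|S| complex matrix and ρ_E an |E|×|E| complex matrix with Tr ρ_E = 1. For each m define Π(m) as the partial trace over E of U†·(I_S ⊗ |m⟩⟨m|)·U·(I_S ⊗ ρ_E), i.e., entrywise Π(m)_{s,s'} := ∑_{e ∈ E} [U†(I_S ⊗ |m⟩⟨m|)U(I_S ⊗ ρ_E)]_{(s,e),(s',e)}. Then for every |S|×|S| matrix A, Tr[(A ⊗ I_E − U†(I_S ⊗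 M_E)U)²·(ρ ⊗ ρ_E)] = ∑_m Tr[(A − a_m·I_S)·Π(m)·(A − a_m·I_S)·ρ]; that is, the error-operator-based (noise-operator) error of the indirect measurement model equals Ozawa's error of the induced measurement. -/
open Matrix
open scoped Kronecker

lemma trace_mul_ptrace_aux {S E : Type*} [Fintype S] [Fintype E] [DecidableEq S] [DecidableEq E]
    (X : Matrix S S ℂ) (W : Matrix (S × E) (S × E) ℂ) :
    Matrix.trace (X * (Matrix.of fun s s' => ∑ e, W (s, e) (s', e))) =
      Matrix.trace ((X ⊗ₖ (1 : Matrix E E ℂ)) * W) := by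
  simp only [Matrix.trace, Matrix.diag, Matrix.mul_apply, Fintype.sum_prod_type, of_apply,
    kroneckerMap_apply, Matrix.one_apply, mul_ite, mul_one, mul_zero, ite_mul, zero_mul,
    Finset.sum_ite_eq, Finset.mem_univ, if_true, Finset.mul_sum]
  refine Finset.sum_congr rfl fun s _ => ?_
  exact Finset.sum_comm

lemma ring_identity_aux {R ι : Type*} [Ring R] [Algebra ℂ R] [Fintype ι] [DecidableEq ι]
    (B : R) (P : ι → R) (c : ι → ℂ) (hP : ∀ m m', P m * P m' = if m = m' then P m else 0)
    (h1 : ∑ m, P m = 1) :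
    (B - ∑ m, c m • P m) ^ 2 = ∑ m, (B - c m • 1) * P m * (B - c m • 1) := by
  have hN : (∑ m, c m • P m) * (∑ m, c m • P m) = ∑ m, (c m * c m) • P m := by
    simp [Finset.sum_mul, Finset.mul_sum, hP, smul_smul]
  have hB : B * B = ∑ m, B * P m * B := by
    rw [← Finset.sum_mul, ← Finset.mul_sum, h1, mul_one]
  rw [sq, sub_mul, mul_sub, mul_sub, hN, hB]
  simp only [sub_mul, mul_sub, Finset.sum_sub_distrib, Finset.mul_sum, Finset.sum_mul,
    smul_mul_assoc, mul_smul_comm, one_mul, mul_one, smul_sub, smul_smul]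
  abel

/-- The error-operator-based (noise-operator) squared error of an indirect measurement
model equals Ozawa's squared error of the induced POVM
`Π(m) = Tr_E[U†(I ⊗ |m⟩⟨m|)U(I ⊗ ρ_E)]`:
`Tr[(A⊗I_E − U†(I⊗M_E)U)²(ρ⊗ρ_E)] = ∑ Tr[(A − a_m I)Π(m)(A − a_m I)ρ]`. -/
theorem error_operator_eq_ozawa_error {S E ι : Type*}
    [Fintype S] [Fintype E] [Fintype ι] [DecidableEq S] [DecidableEq E] [DecidableEq ι]
    (U : Matrix (S × E) (S × E) ℂ) (hU : Uᴴ * U = 1) (hU' : U * Uᴴ = 1)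
    (v : ι → E → ℂ)
    (hortho : ∀ m m', star (v m) ⬝ᵥ v m' = if m = m' then 1 else 0)
    (hcomp : ∑ m, vecMulVec (v m) (star (v m)) = 1)
    (a : ι → ℝ)
    (ρ : Matrix S S ℂ) (ρE : Matrix E E ℂ) (hρE : ρE.trace = 1)
    (A : Matrix S S ℂ) :
    Matrix.trace
        ((A ⊗ₖ (1 : Matrix E E ℂ) -
            Uᴴ * ((1 : Matrix S S ℂ) ⊗ₖ
              (∑ m, (a m : ℂ) • vecMulVec (v m) (star (v m)))) * U) ^ 2 *
          (ρ ⊗ₖ ρE)) =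
      ∑ m, Matrix.trace ((A - (a m : ℂ) • 1) *
          (Matrix.of fun s s' => ∑ e,
            (Uᴴ * ((1 : Matrix S S ℂ) ⊗ₖ vecMulVec (v m) (star (v m))) * U *
              ((1 : Matrix S S ℂ) ⊗ₖ ρE)) (s, e) (s', e)) *
          (A - (a m : ℂ) • 1) * ρ) := by
  set P : ι → Matrix (S × E) (S × E) ℂ := fun m =>
    Uᴴ * ((1 : Matrix S S ℂ) ⊗ₖ vecMulVec (v m) (star (v m))) * U with hPdef
  have hPP : ∀ m m', P m * P m' = if m = m' then P m else 0 := by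
    intro m m'
    have h : P m * P m' = Uᴴ * (((1 : Matrix S S ℂ) ⊗ₖ vecMulVec (v m) (star (v m))) *
        ((1 : Matrix S S ℂ) ⊗ₖ vecMulVec (v m') (star (v m')))) * U := by
      simp only [hPdef, Matrix.mul_assoc]
      rw [← Matrix.mul_assoc U Uᴴ, hU', Matrix.one_mul]
    rw [h, ← mul_kronecker_mul, vecMulVec_mul_vecMulVec, hortho]
    split_ifs with hm
    · subst hm
      simp [hPdef]
    · simp
  have hk : ∀ c : ι → ℂ, Uᴴ * ((1 : Matrix S S ℂ) ⊗ₖ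
      (∑ m, c m • vecMulVec (v m) (star (v m)))) * U = ∑ m, c m • P m := by
    intro c
    have : (1 : Matrix S S ℂ) ⊗ₖ (∑ m, c m • vecMulVec (v m) (star (v m))) =
        ∑ m, c m • ((1 : Matrix S S ℂ) ⊗ₖ vecMulVec (v m) (star (v m))) := by
      ext i j
      simp [Matrix.sum_apply, Finset.mul_sum, mul_left_comm]
    rw [this]
    simp [hPdef, Finset.mul_sum, Finset.sum_mul]
  have hP1 : ∑ m, P m = 1 := by
    have := hk fun _ => 1
    simp only [one_smul, hcomp, one_kronecker_one, Matrix.mul_one, hU] at this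
    exact this.symm
  rw [hk (fun m => (a m : ℂ)), ring_identity_aux _ P _ hPP hP1, Finset.sum_mul, trace_sum]
  refine Finset.sum_congr rfl fun m _ => ?_
  have hA : A ⊗ₖ (1 : Matrix E E ℂ) - (a m : ℂ) • 1 =
      (A - (a m : ℂ) • 1) ⊗ₖ (1 : Matrix E E ℂ) := by
    have h0 : (A - (a m : ℂ) • 1) ⊗ₖ (1 : Matrix E E ℂ) =
        A ⊗ₖ (1 : Matrix E E ℂ) - ((a m : ℂ) • 1) ⊗ₖ (1 : Matrix E E ℂ) := by
      ext i j
      simp only [kroneckerMap_apply, Matrix.sub_apply, sub_mul]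
    rw [h0, smul_kronecker, one_kronecker_one]
  rw [hA]
  generalize A - (a m : ℂ) • 1 = X
  change _ = Matrix.trace (X * (Matrix.of fun s s' => ∑ e,
    (P m * ((1 : Matrix S S ℂ) ⊗ₖ ρE)) (s, e) (s', e)) * X * ρ)
  generalize P m = Q
  rw [Matrix.mul_assoc _ X ρ, Matrix.trace_mul_comm _ (X * ρ), ← Matrix.mul_assoc (X * ρ) X,
    trace_mul_ptrace_aux (X * ρ * X) (Q * ((1 : Matrix S S ℂ) ⊗ₖ ρE))]
  have h2 : (X * ρ * X) ⊗ₖ (1 : Matrix E E ℂ) =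
      ((X * ρ) ⊗ₖ (1 : Matrix E E ℂ)) * (X ⊗ₖ (1 : Matrix E E ℂ)) := by
    rw [← mul_kronecker_mul, Matrix.mul_one]
  rw [h2, Matrix.mul_assoc ((X * ρ) ⊗ₖ _), Matrix.trace_mul_comm ((X * ρ) ⊗ₖ _)]
  simp only [Matrix.mul_assoc]
  rw [← mul_kronecker_mul, ← mul_kronecker_mul]
  simp
end
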